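/- Characterization of the Knothe–Rosenblatt rearrangement via co-monotone recursive maps: Let U₁,…,Uₙ be i.i.d. uniform random variables on [0,1], and let X = (X₁,…,Xₙ) and Y = (Y₁,…,Yₙ) be random vectors defined recursively by X_k = T_k(U_k; X₁,…,X_{k−1}) and Y_k = S_k(U_k; Y₁,…,Y_{k−1}) for measurable functions T_k, S_k such that for every k = 1,…,n and every fixed history argument, the functions u ↦ T_k(u; ·) and u ↦ S_k(u; ·) are co-monotone. Then the joint law of (X,Y) equals the Knothe–Rosenblatt rearrangement π^{KR}_{μ,ν}, where μ = Law(X) and ν = Law(Y). -/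

import Mathlib

open MeasureTheory ProbabilityTheory

noncomputable section

/-- The cumulative distribution function of a measure on `ℝ`: `F_ρ(a) = ρ(−∞, a]`. -/
def cdfAt (ρ : Measure ℝ) (a : ℝ) : ℝ := (ρ (Set.Iic a)).toReal

/-- The left-continuous inverse (quantile function) of the CDF of `ρ`:
`F_ρ^{-1}(y) = inf {u : F_ρ(u) ≥ y}`. -/
def quantile (ρ : Measure ℝ) (y : ℝ) : ℝ := sInf {u : ℝ | y ≤ cdfAt ρ u}

/-- The map sending `x ∈ ℝⁿ` to (its first `k` coordinates, its `(k+1)`-th coordinate). -/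
def splitMap {n : ℕ} (k : ℕ) (hk : k < n) : (Fin n → ℝ) → (Fin k → ℝ) × ℝ :=
  fun x => (fun i => x ⟨i.1, i.2.trans hk⟩, x ⟨k, hk⟩)

/-- The conditional distribution `μ_{x₁,…,x_k}` of the `(k+1)`-th coordinate given the
first `k` coordinates, under a finite measure `μ` on `ℝⁿ`. -/
def condDist {n : ℕ} (μ : Measure (Fin n → ℝ)) [IsFiniteMeasure μ] (k : ℕ) (hk : k < n)
    (x : Fin k → ℝ) : Measure ℝ :=
  haveI := μ.isFiniteMeasure_map (splitMap k hk)
  (μ.map (splitMap k hk)).condKernel x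

/-- The recursively defined Knothe–Rosenblatt transform:
`X_k = F_{μ_{X₁,…,X_{k−1}}}^{-1}(u_k)`. -/
def krVal {n : ℕ} (μ : Measure (Fin n → ℝ)) [IsFiniteMeasure μ] (u : Fin n → ℝ) :
    (k : ℕ) → k < n → ℝ
  | k, hk =>
      quantile (condDist μ k hk (fun i : Fin k => krVal μ u i.1 (i.2.trans hk))) (u ⟨k, hk⟩)
  termination_by k _ => k
  decreasing_by exact i.2

/-- The Knothe–Rosenblatt (Monge) map applied to a vector of uniforms. -/
def krX {n : ℕ} (μ : Measure (Fin n → ℝ)) [IsFiniteMeasure μ] (u : Fin n → ℝ) : Fin n → ℝ :=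
  fun k => krVal μ u k.1 k.2

/-- The uniform measure on the cube `[0,1]ⁿ` (law of `n` i.i.d. uniforms `U₁,…,Uₙ`). -/
def uniformCube (n : ℕ) : Measure (Fin n → ℝ) :=
  Measure.pi fun _ => volume.restrict (Set.Icc (0 : ℝ) 1)

/-- The Knothe–Rosenblatt rearrangement `π^{KR}_{μ,ν}`: the joint law of
`(X₁,…,Xₙ,Y₁,…,Yₙ)` where `X_k = F_{μ_{X₁,…,X_{k−1}}}^{-1}(U_k)` and
`Y_k = F_{ν_{Y₁,…,Y_{k−1}}}^{-1}(U_k)` for i.i.d. uniforms `U₁,…,Uₙ` on `[0,1]`. -/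
def KR {n : ℕ} (μ ν : Measure (Fin n → ℝ)) [IsFiniteMeasure μ] [IsFiniteMeasure ν] :
    Measure ((Fin n → ℝ) × (Fin n → ℝ)) :=
  (uniformCube n).map fun u => (krX μ u, krX ν u)

/-- Two functions `ℝ → ℝ` are co-monotone if both are increasing (weakly), both are
decreasing (weakly), or at least one of them is constant. -/
def CoMonotone (f g : ℝ → ℝ) : Prop :=
  (Monotone f ∧ Monotone g) ∨ (Antitone f ∧ Antitone g) ∨
    (∃ c, f = fun _ => c) ∨ (∃ c, g = fun _ => c)

def lamU : Measure ℝ := volume.restrict (Set.Icc (0 : ℝ) 1)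

instance : IsProbabilityMeasure lamU := ⟨by simp [lamU]⟩

lemma cdfAt_eq (ρ : Measure ℝ) [IsProbabilityMeasure ρ] (a : ℝ) : cdfAt ρ a = cdf ρ a := by
  rw [cdf_eq_real]; rfl

lemma quantile_le_iff (ρ : Measure ℝ) [IsProbabilityMeasure ρ] (u c : ℝ) :
    quantile ρ u ≤ c ↔ (0 < u ∧ u ≤ cdfAt ρ c) ∨ ((u ≤ 0 ∨ ∀ n : ℕ, cdfAt ρ n < u) ∧ 0 ≤ c) := by
  have hset : {a : ℝ | u ≤ cdfAt ρ a} = {a : ℝ | u ≤ cdf ρ a} := by ext a; simp [cdfAt_eq]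
  unfold quantile
  rw [hset]
  simp only [cdfAt_eq]
  have hmono := monotone_cdf ρ
  rcases le_or_gt u 0 with hu | hu
  · have : {a : ℝ | u ≤ cdf ρ a} = Set.univ := by
      ext a; simpa using hu.trans (cdf_nonneg ρ a)
    rw [this, Real.sInf_univ]
    simp [hu, not_lt.mpr hu]
  · have hbdd : BddBelow {a : ℝ | u ≤ cdf ρ a} := by
      have h := (tendsto_cdf_atBot ρ).eventually (gt_mem_nhds hu)
      obtain ⟨b, hb⟩ := h.exists
      refine ⟨b, fun a ha => ?_⟩
      by_contra hab
      push Not at hab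
      have := hmono hab.le
      simp only [Set.mem_ofPred_eq] at ha
      linarith
    by_cases hne : {a : ℝ | u ≤ cdf ρ a}.Nonempty
    · have hn : ¬ ∀ n : ℕ, cdf ρ n < u := by
        intro h
        obtain ⟨a, ha⟩ := hne
        obtain ⟨n, hn⟩ := exists_nat_ge a
        have := h n
        have := hmono hn
        simp only [Set.mem_ofPred_eq] at ha
        linarith
      have hmem : u ≤ cdf ρ (sInf {a : ℝ | u ≤ cdf ρ a}) := by
        have hr := (cdf ρ).right_continuous (sInf {a : ℝ | u ≤ cdf ρ a})
        have hr' : Filter.Tendsto (cdf ρ) (nhdsWithin (sInf {a : ℝ | u ≤ cdf ρ a}) (Set.Ioi _))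
            (nhds (cdf ρ (sInf {a : ℝ | u ≤ cdf ρ a}))) :=
          hr.tendsto.mono_left (nhdsWithin_mono _ Set.Ioi_subset_Ici_self)
        refine ge_of_tendsto hr' ?_
        filter_upwards [self_mem_nhdsWithin] with x hx
        obtain ⟨a, ha, hax⟩ := exists_lt_of_csInf_lt hne hx
        exact le_trans ha (hmono hax.le)
      constructor
      · intro h
        exact Or.inl ⟨hu, hmem.trans (hmono h)⟩
      · rintro (⟨-, h⟩ | ⟨h | h, -⟩)
        · exact csInf_le hbdd h
        · exact absurd hu (not_lt.mpr h)
        · exact absurd h hn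
    · have hemp := Set.not_nonempty_iff_eq_empty.mp hne
      rw [hemp, Real.sInf_empty]
      have hall : ∀ a, cdf ρ a < u := fun a => by
        by_contra h
        exact hne ⟨a, not_lt.mp h⟩
      constructor
      · intro h
        exact Or.inr ⟨Or.inr fun n => hall n, h⟩
      · rintro (⟨-, h⟩ | ⟨-, h⟩)
        · exact absurd h (not_le.mpr (hall c))
        · exact h

lemma measurable_quantile_kernel {α : Type*} [MeasurableSpace α] (κ : Kernel α ℝ)
    [IsMarkovKernel κ] : Measurable fun p : ℝ × α => quantile (κ p.2) p.1 := by
  refine measurable_of_Iic fun c => ?_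
  have hF : ∀ a : ℝ, Measurable fun p : ℝ × α => cdfAt (κ p.2) a := fun a =>
    ((κ.measurable_coe measurableSet_Iic).comp measurable_snd).ennreal_toReal
  have : (fun p : ℝ × α => quantile (κ p.2) p.1) ⁻¹' Set.Iic c =
      {p | (0 < p.1 ∧ p.1 ≤ cdfAt (κ p.2) c) ∨
        ((p.1 ≤ 0 ∨ ∀ n : ℕ, cdfAt (κ p.2) n < p.1) ∧ 0 ≤ c)} := by
    ext p
    exact quantile_le_iff (κ p.2) p.1 c
  rw [this]
  refine ((measurableSet_lt measurable_const measurable_fst).inter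
    (measurableSet_le measurable_fst (hF c))).union
    (((measurableSet_le measurable_fst measurable_const).union ?_).inter (MeasurableSet.const _))
  have : {p : ℝ × α | ∀ n : ℕ, cdfAt (κ p.2) n < p.1} =
      ⋂ n : ℕ, {p : ℝ × α | cdfAt (κ p.2) n < p.1} := by ext; simp
  have hm : MeasurableSet {p : ℝ × α | ∀ n : ℕ, cdfAt (κ p.2) n < p.1} := by
    rw [this]
    exact MeasurableSet.iInter fun n => measurableSet_lt (hF n) measurable_fst
  exact hm

lemma measurable_quantile (ρ : Measure ℝ) [IsProbabilityMeasure ρ] :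
    Measurable (quantile ρ) :=
  (measurable_quantile_kernel (Kernel.const Unit ρ)).comp
    (measurable_id.prodMk (measurable_const (a := ())))

lemma lamU_ae : ∀ᵐ u ∂lamU, 0 < u ∧ u < 1 := by
  unfold lamU
  rw [← Measure.restrict_congr_set (Ioo_ae_eq_Icc (μ := volume) (a := (0:ℝ)) (b := 1))]
  exact ae_restrict_mem measurableSet_Ioo

lemma lamU_Iic {t : ℝ} (h0 : 0 ≤ t) (h1 : t ≤ 1) : lamU (Set.Iic t) = ENNReal.ofReal t := by
  unfold lamU
  rw [Measure.restrict_apply measurableSet_Iic]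
  have : Set.Iic t ∩ Set.Icc (0 : ℝ) 1 = Set.Icc 0 t := by
    ext x; simp only [Set.mem_inter_iff, Set.mem_Iic, Set.mem_Icc]
    constructor
    · rintro ⟨a, b, c⟩; exact ⟨b, a⟩
    · rintro ⟨a, b⟩; exact ⟨b, a, b.trans h1⟩
  rw [this]; simp

lemma ae_quantile_le (ρ : Measure ℝ) [IsProbabilityMeasure ρ] (a : ℝ) :
    ∀ᵐ u ∂lamU, (quantile ρ u ≤ a ↔ u ≤ cdfAt ρ a) := by
  filter_upwards [lamU_ae] with u hu
  rw [quantile_le_iff]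
  have : ¬ ∀ n : ℕ, cdfAt ρ n < u := by
    intro h
    have h1 := ((tendsto_cdf_atTop ρ).comp tendsto_natCast_atTop_atTop).eventually
      (lt_mem_nhds hu.2)
    obtain ⟨n, hn⟩ := h1.exists
    have := h n
    rw [cdfAt_eq] at this
    simp only [Function.comp] at hn
    linarith
  simp [hu.1, this, not_le.mpr hu.1]

lemma measure_ext_Iic_prod {ρ σ : Measure (ℝ × ℝ)} [IsProbabilityMeasure ρ]
    [IsProbabilityMeasure σ]
    (h : ∀ a b, ρ (Set.Iic a ×ˢ Set.Iic b) = σ (Set.Iic a ×ˢ Set.Iic b)) : ρ = σ := by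
  have hs : IsCountablySpanning (Set.range (Set.Iic : ℝ → Set ℝ)) :=
    ⟨fun n : ℕ => Set.Iic (n : ℝ), fun n => ⟨_, rfl⟩, by
      ext x; simpa using exists_nat_ge x⟩
  refine ext_of_generate_finite
    (Set.image2 (· ×ˢ ·) (Set.range (Set.Iic : ℝ → Set ℝ)) (Set.range (Set.Iic : ℝ → Set ℝ))) ?_
    (isPiSystem_Iic.prod isPiSystem_Iic) ?_ (by simp)
  · rw [← generateFrom_prod_eq hs hs, ← borel_eq_generateFrom_Iic]
  · rintro _ ⟨_, ⟨a, rfl⟩, _, ⟨b, rfl⟩, rfl⟩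
    exact h a b

lemma CoMonotone.nested {f g : ℝ → ℝ} (h : CoMonotone f g) (a b : ℝ) :
    f ⁻¹' Set.Iic a ⊆ g ⁻¹' Set.Iic b ∨ g ⁻¹' Set.Iic b ⊆ f ⁻¹' Set.Iic a := by
  by_contra hc
  simp only [not_or, Set.not_subset, Set.mem_preimage, Set.mem_Iic, not_le] at hc
  obtain ⟨⟨x, hx1, hx2⟩, ⟨y, hy1, hy2⟩⟩ := hc
  rcases h with ⟨hf, hg⟩ | ⟨hf, hg⟩ | ⟨c, rfl⟩ | ⟨c, rfl⟩
  · rcases le_total x y with hxy | hxy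
    · have := hg hxy; linarith
    · have := hf hxy; linarith
  · rcases le_total x y with hxy | hxy
    · have := hf hxy; linarith
    · have := hg hxy; linarith
  · linarith
  · linarith

lemma comonotone_law {f g : ℝ → ℝ} (hf : Measurable f) (hg : Measurable g)
    (h : CoMonotone f g) :
    lamU.map (fun u => (f u, g u)) =
      lamU.map (fun u => (quantile (lamU.map f) u, quantile (lamU.map g) u)) := by
  have := Measure.isProbabilityMeasure_map (μ := lamU) hf.aemeasurable
  have := Measure.isProbabilityMeasure_map (μ := lamU) hg.aemeasurable
  have hqf := measurable_quantile (lamU.map f)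
  have hqg := measurable_quantile (lamU.map g)
  have := Measure.isProbabilityMeasure_map (μ := lamU) (hf.prodMk hg).aemeasurable
  have := Measure.isProbabilityMeasure_map (μ := lamU) (hqf.prodMk hqg).aemeasurable
  refine measure_ext_Iic_prod fun a b => ?_
  rw [Measure.map_apply (hf.prodMk hg) (measurableSet_Iic.prod measurableSet_Iic),
    Measure.map_apply (hqf.prodMk hqg) (measurableSet_Iic.prod measurableSet_Iic)]
  set F := cdfAt (lamU.map f) a with hF
  set G := cdfAt (lamU.map g) b with hG
  have hF' : lamU (f ⁻¹' Set.Iic a) = ENNReal.ofReal F := by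
    rw [hF, cdfAt, Measure.map_apply hf measurableSet_Iic, ENNReal.ofReal_toReal (measure_ne_top _ _)]
  have hG' : lamU (g ⁻¹' Set.Iic b) = ENNReal.ofReal G := by
    rw [hG, cdfAt, Measure.map_apply hg measurableSet_Iic, ENNReal.ofReal_toReal (measure_ne_top _ _)]
  have h1 : lamU ((fun u => (f u, g u)) ⁻¹' (Set.Iic a ×ˢ Set.Iic b)) =
      ENNReal.ofReal (min F G) := by
    have e : (fun u => (f u, g u)) ⁻¹' (Set.Iic a ×ˢ Set.Iic b) =
      f ⁻¹' Set.Iic a ∩ g ⁻¹' Set.Iic b := by ext; simp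
    rw [e, ENNReal.ofReal_min, ← hF', ← hG']
    rcases h.nested a b with hh | hh
    · rw [Set.inter_eq_left.mpr hh, min_eq_left (measure_mono hh)]
    · rw [Set.inter_eq_right.mpr hh, min_eq_right (measure_mono hh)]
  rw [h1, ← lamU_Iic (t := min F G)]
  · refine measure_congr ?_
    filter_upwards [ae_quantile_le (lamU.map f) a, ae_quantile_le (lamU.map g) b] with u hu1 hu2
    apply propext
    change u ≤ min F G ↔ (quantile (lamU.map f) u ≤ a ∧ quantile (lamU.map g) u ≤ b)
    rw [hu1, hu2, le_min_iff]
  · exact le_min ENNReal.toReal_nonneg ENNReal.toReal_nonneg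
  · refine (min_le_left _ _).trans ?_
    rw [hF, cdfAt_eq]; exact cdf_le_one _ _

def histv {n : ℕ} (k : ℕ) (hk : k ≤ n) (x : Fin n → ℝ) : Fin k → ℝ :=
  fun i => x ⟨i.1, lt_of_lt_of_le i.2 hk⟩

lemma measurable_histv {n : ℕ} (k : ℕ) (hk : k ≤ n) : Measurable (histv (n := n) k hk) :=
  measurable_pi_lambda _ fun _ => measurable_pi_apply _

lemma measurable_snocv (k : ℕ) :
    Measurable fun p : (Fin k → ℝ) × ℝ => (Fin.snoc p.1 p.2 : Fin (k + 1) → ℝ) := by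
  refine measurable_pi_lambda _ fun i => ?_
  refine Fin.lastCases ?_ (fun j => ?_) i
  · simpa using measurable_snd
  · simpa [Function.comp_def] using (measurable_pi_apply j).comp (measurable_fst (α := Fin k → ℝ) (β := ℝ))

lemma histv_succ {n : ℕ} (k : ℕ) (hk : k + 1 ≤ n) (x : Fin n → ℝ) :
    histv (k + 1) hk x = Fin.snoc (histv k (Nat.le_of_succ_le hk) x) (x ⟨k, hk⟩) := by
  funext i
  refine Fin.lastCases ?_ (fun j => ?_) i
  · simp [histv]
  · simp [histv]

section proc

variable {Ω : Type*} [MeasurableSpace Ω] {n : ℕ}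

lemma exists_phi (U : Fin n → Ω → ℝ) (T : (k : Fin n) → ℝ → (Fin (k : ℕ) → ℝ) → ℝ)
    (hT : ∀ k : Fin n, Measurable fun p : ℝ × (Fin (k : ℕ) → ℝ) => T k p.1 p.2)
    (X : Ω → Fin n → ℝ)
    (hX : ∀ ω (k : Fin n), X ω k = T k (U k ω) (histv k k.2.le (X ω)))
    (k : ℕ) (hk : k ≤ n) :
    ∃ φ : (Fin k → ℝ) → (Fin k → ℝ), Measurable φ ∧
      ∀ ω, histv k hk (X ω) = φ (histv k hk fun i => U i ω) := by
  induction k with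
  | zero => exact ⟨id, measurable_id, fun ω => Subsingleton.elim _ _⟩
  | succ k ih =>
    obtain ⟨φ, hφ, h⟩ := ih (Nat.le_of_succ_le hk)
    have hi : Measurable fun u : Fin (k + 1) → ℝ => φ (fun i => u i.castSucc) :=
      hφ.comp (measurable_pi_lambda _ fun i => measurable_pi_apply _)
    refine ⟨fun u => Fin.snoc (φ fun i => u i.castSucc)
      (T ⟨k, hk⟩ (u (Fin.last k)) (φ fun i => u i.castSucc)), ?_, fun ω => ?_⟩
    · exact (measurable_snocv k).comp (hi.prodMk
        ((hT ⟨k, hk⟩).comp ((measurable_pi_apply (Fin.last k)).prodMk hi)))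
    · rw [histv_succ, hX ω ⟨k, hk⟩]
      change (Fin.snoc (histv k _ (X ω)) (T ⟨k, hk⟩ (U ⟨k, hk⟩ ω) (histv k _ (X ω))) : Fin (k + 1) → ℝ) = _
      rw [h ω]
      rfl

lemma indep_hist (P : Measure Ω) [IsProbabilityMeasure P] (U : Fin n → Ω → ℝ)
    (hU : ∀ k, Measurable (U k)) (hind : iIndepFun U P) (k : ℕ) (hk : k < n) :
    IndepFun (fun ω => histv k hk.le fun i => U i ω) (U ⟨k, hk⟩) P := by
  have hd : Disjoint (Finset.univ.filter fun i : Fin n => i.1 < k) {(⟨k, hk⟩ : Fin n)} := by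
    simp
  have h := hind.indepFun_finset _ _ hd hU
  let a : ((Finset.univ.filter fun i : Fin n => i.1 < k) → ℝ) → (Fin k → ℝ) :=
    fun v i => v ⟨⟨i.1, i.2.trans hk⟩, by simp⟩
  let b : (({(⟨k, hk⟩ : Fin n)} : Finset (Fin n)) → ℝ) → ℝ :=
    fun v => v ⟨⟨k, hk⟩, by simp⟩
  have ha : Measurable a := measurable_pi_lambda _ fun i => measurable_pi_apply _
  have hb : Measurable b := measurable_pi_apply _
  exact h.comp ha hb

/-- kernel sending `z` to the law of `G (z, U)`, `U` uniform. -/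
def gk {β γ : Type*} [MeasurableSpace β] [MeasurableSpace γ] (G : β × ℝ → γ) : Kernel β γ :=
  (Kernel.id ×ₖ Kernel.const β lamU).map G

lemma gk_apply {β γ : Type*} [MeasurableSpace β] [MeasurableSpace γ] {G : β × ℝ → γ}
    (hG : Measurable G) (z : β) : gk G z = lamU.map fun u => G (z, u) := by
  rw [gk, Kernel.map_apply _ hG, Kernel.prod_apply, Kernel.id_apply, Kernel.const_apply,
    Measure.dirac_prod, Measure.map_map hG measurable_prodMk_left]
  rfl

lemma gk_markov {β γ : Type*} [MeasurableSpace β] [MeasurableSpace γ] {G : β × ℝ → γ}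
    (hG : Measurable G) : IsMarkovKernel (gk G) := by
  unfold gk; exact Kernel.IsMarkovKernel.map _ hG

lemma law_step {β γ : Type*} [MeasurableSpace β] [MeasurableSpace γ] {G : β × ℝ → γ}
    (hG : Measurable G) (P : Measure Ω) [IsProbabilityMeasure P] {Z : Ω → β} {V : Ω → ℝ}
    (hZ : Measurable Z) (hV : Measurable V) (hVl : P.map V = lamU) (hi : IndepFun Z V P) :
    P.map (fun ω => (Z ω, G (Z ω, V ω))) = (P.map Z) ⊗ₘ gk G := by
  have hj := (indepFun_iff_map_prod_eq_prod_map_map hZ.aemeasurable hV.aemeasurable).1 hi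
  rw [hVl] at hj
  have := gk_markov hG
  have := Measure.isProbabilityMeasure_map (μ := P) hZ.aemeasurable
  have hm : Measurable fun p : β × ℝ => (p.1, G p) := measurable_fst.prodMk hG
  have e : P.map (fun ω => (Z ω, G (Z ω, V ω))) =
      (P.map fun ω => (Z ω, V ω)).map fun p => (p.1, G p) := by
    rw [Measure.map_map hm (hZ.prodMk hV)]; rfl
  rw [e, hj]
  ext s hs
  rw [Measure.map_apply hm hs, Measure.prod_apply (hm hs), Measure.compProd_apply hs]
  refine lintegral_congr fun z => ?_
  rw [gk_apply hG, Measure.map_apply (f := fun u => G (z, u)) (hG.comp measurable_prodMk_left) (measurable_prodMk_left hs)]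
  rfl

lemma condDist_ae (P : Measure Ω) [IsProbabilityMeasure P] (U : Fin n → Ω → ℝ)
    (hU : ∀ k, Measurable (U k)) (hind : iIndepFun U P) (hUl : ∀ k, P.map (U k) = lamU)
    (T : (k : Fin n) → ℝ → (Fin (k : ℕ) → ℝ) → ℝ)
    (hT : ∀ k : Fin n, Measurable fun p : ℝ × (Fin (k : ℕ) → ℝ) => T k p.1 p.2)
    (X : Ω → Fin n → ℝ) (hXm : Measurable X)
    (hX : ∀ ω (k : Fin n), X ω k = T k (U k ω) (histv k k.2.le (X ω)))
    (μ : Measure (Fin n → ℝ)) [IsProbabilityMeasure μ] (hμ : μ = P.map X)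
    (k : ℕ) (hk : k < n) :
    ∀ᵐ x ∂(P.map fun ω => histv k hk.le (X ω)), condDist μ k hk x =
      lamU.map (fun u => T ⟨k, hk⟩ u x) := by
  have hsm : Measurable (splitMap (n := n) k hk) :=
    (measurable_histv k hk.le).prodMk (measurable_pi_apply _)
  have hG : Measurable fun p : (Fin k → ℝ) × ℝ => T ⟨k, hk⟩ p.2 p.1 :=
    (hT ⟨k, hk⟩).comp measurable_swap
  have hZ : Measurable fun ω => histv k hk.le (X ω) := (measurable_histv k hk.le).comp hXm
  obtain ⟨φ, hφ, h⟩ := exists_phi U T hT X hX k hk.le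
  have hi : IndepFun (fun ω => histv k hk.le (X ω)) (U ⟨k, hk⟩) P := by
    have := (indep_hist P U hU hind k hk).comp hφ measurable_id
    simp_rw [h]
    exact this
  have hs := law_step hG P hZ (hU ⟨k, hk⟩) (hUl _) hi
  have hmap : μ.map (splitMap k hk) =
      (P.map fun ω => histv k hk.le (X ω)) ⊗ₘ gk fun p : (Fin k → ℝ) × ℝ => T ⟨k, hk⟩ p.2 p.1 := by
    rw [← hs, hμ, Measure.map_map hsm hXm]
    congr 1
    funext ω
    exact Prod.ext rfl (hX ω ⟨k, hk⟩)
  have hfst : (μ.map (splitMap k hk)).fst = P.map fun ω => histv k hk.le (X ω) := by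
    rw [hμ, Measure.map_map hsm hXm, Measure.fst, Measure.map_map measurable_fst (hsm.comp hXm)]
    rfl
  have := gk_markov hG
  have := μ.isFiniteMeasure_map (splitMap k hk)
  have hc := eq_condKernel_of_measure_eq_compProd (ρ := μ.map (splitMap k hk))
    (gk fun p : (Fin k → ℝ) × ℝ => T ⟨k, hk⟩ p.2 p.1) (by rw [hfst]; exact hmap)
  rw [hfst] at hc
  filter_upwards [hc] with ω hω
  rw [gk_apply hG] at hω
  exact hω.symm

def stepG (T S : (k : Fin n) → ℝ → (Fin (k : ℕ) → ℝ) → ℝ) (k : ℕ) (hk : k < n) :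
    ((Fin k → ℝ) × (Fin k → ℝ)) × ℝ → ℝ × ℝ :=
  fun p => (T ⟨k, hk⟩ p.2 p.1.1, S ⟨k, hk⟩ p.2 p.1.2)

def joinv (k : ℕ) (p : ((Fin k → ℝ) × (Fin k → ℝ)) × (ℝ × ℝ)) :
    (Fin (k + 1) → ℝ) × (Fin (k + 1) → ℝ) :=
  (Fin.snoc p.1.1 p.2.1, Fin.snoc p.1.2 p.2.2)

lemma measurable_joinv (k : ℕ) : Measurable (joinv k) :=
  ((measurable_snocv k).comp (f := fun p : ((Fin k → ℝ) × (Fin k → ℝ)) × (ℝ × ℝ) =>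
      (p.1.1, p.2.1)) (by fun_prop)).prodMk
    ((measurable_snocv k).comp (f := fun p : ((Fin k → ℝ) × (Fin k → ℝ)) × (ℝ × ℝ) =>
      (p.1.2, p.2.2)) (by fun_prop))

lemma measurable_stepG (T S : (k : Fin n) → ℝ → (Fin (k : ℕ) → ℝ) → ℝ)
    (hT : ∀ k : Fin n, Measurable fun p : ℝ × (Fin (k : ℕ) → ℝ) => T k p.1 p.2)
    (hS : ∀ k : Fin n, Measurable fun p : ℝ × (Fin (k : ℕ) → ℝ) => S k p.1 p.2)
    (k : ℕ) (hk : k < n) : Measurable (stepG T S k hk) :=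
  ((hT ⟨k, hk⟩).comp (f := fun p : ((Fin k → ℝ) × (Fin k → ℝ)) × ℝ => (p.2, p.1.1))
      (by fun_prop)).prodMk
    ((hS ⟨k, hk⟩).comp (f := fun p : ((Fin k → ℝ) × (Fin k → ℝ)) × ℝ => (p.2, p.1.2))
      (by fun_prop))

lemma hist_pair (P : Measure Ω) [IsProbabilityMeasure P] (U : Fin n → Ω → ℝ)
    (hU : ∀ k, Measurable (U k)) (hind : iIndepFun U P)
    (T S : (k : Fin n) → ℝ → (Fin (k : ℕ) → ℝ) → ℝ)
    (hT : ∀ k : Fin n, Measurable fun p : ℝ × (Fin (k : ℕ) → ℝ) => T k p.1 p.2)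
    (hS : ∀ k : Fin n, Measurable fun p : ℝ × (Fin (k : ℕ) → ℝ) => S k p.1 p.2)
    (X Y : Ω → Fin n → ℝ)
    (hX : ∀ ω (k : Fin n), X ω k = T k (U k ω) (histv k k.2.le (X ω)))
    (hY : ∀ ω (k : Fin n), Y ω k = S k (U k ω) (histv k k.2.le (Y ω)))
    (k : ℕ) (hk : k < n) :
    Measurable (fun ω => (histv k hk.le (X ω), histv k hk.le (Y ω))) ∧
    IndepFun (fun ω => (histv k hk.le (X ω), histv k hk.le (Y ω))) (U ⟨k, hk⟩) P := by
  obtain ⟨φ, hφ, h⟩ := exists_phi U T hT X hX k hk.le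
  obtain ⟨ψ, hψ, h'⟩ := exists_phi U S hS Y hY k hk.le
  simp_rw [h, h']
  have hUm : Measurable fun ω => histv k hk.le fun i => U i ω :=
    (measurable_histv k hk.le).comp (measurable_pi_lambda _ hU)
  exact ⟨(hφ.comp hUm).prodMk (hψ.comp hUm),
    (indep_hist P U hU hind k hk).comp (hφ.prodMk hψ) measurable_id⟩

lemma law_succ (P : Measure Ω) [IsProbabilityMeasure P] (U : Fin n → Ω → ℝ)
    (hU : ∀ k, Measurable (U k)) (hind : iIndepFun U P) (hUl : ∀ k, P.map (U k) = lamU)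
    (T S : (k : Fin n) → ℝ → (Fin (k : ℕ) → ℝ) → ℝ)
    (hT : ∀ k : Fin n, Measurable fun p : ℝ × (Fin (k : ℕ) → ℝ) => T k p.1 p.2)
    (hS : ∀ k : Fin n, Measurable fun p : ℝ × (Fin (k : ℕ) → ℝ) => S k p.1 p.2)
    (X Y : Ω → Fin n → ℝ)
    (hX : ∀ ω (k : Fin n), X ω k = T k (U k ω) (histv k k.2.le (X ω)))
    (hY : ∀ ω (k : Fin n), Y ω k = S k (U k ω) (histv k k.2.le (Y ω)))
    (k : ℕ) (hk : k < n) :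
    P.map (fun ω => (histv (k + 1) hk (X ω), histv (k + 1) hk (Y ω))) =
      ((P.map fun ω => (histv k hk.le (X ω), histv k hk.le (Y ω))) ⊗ₘ
        gk (stepG T S k hk)).map (joinv k) := by
  have hG := measurable_stepG T S hT hS k hk
  obtain ⟨hZ, hi⟩ := hist_pair P U hU hind T S hT hS X Y hX hY k hk
  rw [← law_step hG P hZ (hU ⟨k, hk⟩) (hUl _) hi,
    Measure.map_map (measurable_joinv k) (by exact hZ.prodMk (hG.comp (hZ.prodMk (hU ⟨k, hk⟩))))]
  congr 1
  funext ω
  refine Prod.ext ?_ ?_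
  · change histv (k + 1) hk (X ω) = _
    rw [histv_succ, hX ω ⟨k, hk⟩]; rfl
  · change histv (k + 1) hk (Y ω) = _
    rw [histv_succ, hY ω ⟨k, hk⟩]; rfl

lemma coupling {Ω' : Type*} [MeasurableSpace Ω']
    (P : Measure Ω) [IsProbabilityMeasure P] (U : Fin n → Ω → ℝ)
    (hU : ∀ k, Measurable (U k)) (hind : iIndepFun U P) (hUl : ∀ k, P.map (U k) = lamU)
    (P' : Measure Ω') [IsProbabilityMeasure P'] (U' : Fin n → Ω' → ℝ)
    (hU' : ∀ k, Measurable (U' k)) (hind' : iIndepFun U' P') (hUl' : ∀ k, P'.map (U' k) = lamU)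
    (T S T' S' : (k : Fin n) → ℝ → (Fin (k : ℕ) → ℝ) → ℝ)
    (hT : ∀ k : Fin n, Measurable fun p : ℝ × (Fin (k : ℕ) → ℝ) => T k p.1 p.2)
    (hS : ∀ k : Fin n, Measurable fun p : ℝ × (Fin (k : ℕ) → ℝ) => S k p.1 p.2)
    (hT' : ∀ k : Fin n, Measurable fun p : ℝ × (Fin (k : ℕ) → ℝ) => T' k p.1 p.2)
    (hS' : ∀ k : Fin n, Measurable fun p : ℝ × (Fin (k : ℕ) → ℝ) => S' k p.1 p.2)
    (X Y : Ω → Fin n → ℝ) (X' Y' : Ω' → Fin n → ℝ)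
    (hX : ∀ ω (k : Fin n), X ω k = T k (U k ω) (histv k k.2.le (X ω)))
    (hY : ∀ ω (k : Fin n), Y ω k = S k (U k ω) (histv k k.2.le (Y ω)))
    (hX' : ∀ ω (k : Fin n), X' ω k = T' k (U' k ω) (histv k k.2.le (X' ω)))
    (hY' : ∀ ω (k : Fin n), Y' ω k = S' k (U' k ω) (histv k k.2.le (Y' ω)))
    (hlaw : ∀ (k : ℕ) (hk : k < n),
      ∀ᵐ z ∂(P.map (fun ω => (histv k hk.le (X ω), histv k hk.le (Y ω)))),
      lamU.map (fun u => (T ⟨k, hk⟩ u z.1, S ⟨k, hk⟩ u z.2)) =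
      lamU.map (fun u => (T' ⟨k, hk⟩ u z.1, S' ⟨k, hk⟩ u z.2)))
    (k : ℕ) (hk : k ≤ n) :
    P.map (fun ω => (histv k hk (X ω), histv k hk (Y ω))) =
      P'.map (fun ω => (histv k hk (X' ω), histv k hk (Y' ω))) := by
  induction k with
  | zero =>
    have e1 : (fun ω => (histv 0 hk (X ω), histv 0 hk (Y ω))) = fun _ => default :=
      funext fun _ => Subsingleton.elim _ _
    have e2 : (fun ω => (histv 0 hk (X' ω), histv 0 hk (Y' ω))) = fun _ => default :=
      funext fun _ => Subsingleton.elim _ _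
    rw [e1, e2]
    simp [Measure.map_const]
  | succ k ih =>
    have hk' : k < n := hk
    have ih := ih hk'.le
    rw [law_succ P U hU hind hUl T S hT hS X Y hX hY k hk',
      law_succ P' U' hU' hind' hUl' T' S' hT' hS' X' Y' hX' hY' k hk', ← ih]
    congr 1
    have hG := measurable_stepG T S hT hS k hk'
    have hG' := measurable_stepG T' S' hT' hS' k hk'
    have := gk_markov hG
    have := gk_markov hG'
    refine Measure.compProd_congr ?_
    filter_upwards [hlaw k hk'] with z hz
    rw [gk_apply hG, gk_apply hG']
    exact hz

end proc

/-- **Characterization of the Knothe–Rosenblatt rearrangement via co-monotone recursive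
maps.** If `X_k = T_k(U_k; X₁,…,X_{k−1})` and `Y_k = S_k(U_k; Y₁,…,Y_{k−1})` for i.i.d.
uniforms `U₁,…,Uₙ` on `[0,1]` and measurable maps `T_k, S_k` which, for every fixed
history argument, are co-monotone in their first argument, then the joint law of
`(X, Y)` equals the Knothe–Rosenblatt rearrangement between `μ = Law(X)` and
`ν = Law(Y)`. -/
theorem kr_characterization_comonotone
    {Ω : Type*} [MeasurableSpace Ω] (P : Measure Ω) [IsProbabilityMeasure P] {n : ℕ}
    (U : Fin n → Ω → ℝ) (hUmeas : ∀ k, Measurable (U k))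
    (hUindep : iIndepFun U P)
    (hUunif : ∀ k, P.map (U k) = volume.restrict (Set.Icc (0 : ℝ) 1))
    (T S : (k : Fin n) → ℝ → (Fin (k : ℕ) → ℝ) → ℝ)
    (hTmeas : ∀ k : Fin n, Measurable fun p : ℝ × (Fin (k : ℕ) → ℝ) => T k p.1 p.2)
    (hSmeas : ∀ k : Fin n, Measurable fun p : ℝ × (Fin (k : ℕ) → ℝ) => S k p.1 p.2)
    (hco : ∀ (k : Fin n) (xh yh : Fin (k : ℕ) → ℝ),
      CoMonotone (fun u => T k u xh) (fun u => S k u yh))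
    (X Y : Ω → Fin n → ℝ) (hX : Measurable X) (hY : Measurable Y)
    (hXrec : ∀ ω (k : Fin n),
      X ω k = T k (U k ω) fun i : Fin (k : ℕ) => X ω ⟨i.1, i.2.trans k.2⟩)
    (hYrec : ∀ ω (k : Fin n),
      Y ω k = S k (U k ω) fun i : Fin (k : ℕ) => Y ω ⟨i.1, i.2.trans k.2⟩)
    (μ ν : Measure (Fin n → ℝ)) [IsProbabilityMeasure μ] [IsProbabilityMeasure ν]
    (hμ : μ = P.map X) (hν : ν = P.map Y) :
    P.map (fun ω => (X ω, Y ω)) = KR μ ν := by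
  have hUl : ∀ k, P.map (U k) = lamU := hUunif
  have : IsProbabilityMeasure (uniformCube n) := by
    change IsProbabilityMeasure (Measure.pi fun _ : Fin n => lamU)
    infer_instance
  have hU' : ∀ k : Fin n, Measurable fun u : Fin n → ℝ => u k := fun k => measurable_pi_apply k
  have hind' : iIndepFun (fun (k : Fin n) (u : Fin n → ℝ) => u k) (uniformCube n) :=
    iIndepFun_pi (μ := fun _ : Fin n => lamU) (X := fun _ x => x) fun _ => aemeasurable_id
  have hUl' : ∀ k : Fin n, (uniformCube n).map (fun u : Fin n → ℝ => u k) = lamU := fun k =>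
    (measurePreserving_eval (fun _ : Fin n => lamU) k).map_eq
  have hq : ∀ (ρ : Measure (Fin n → ℝ)) [IsProbabilityMeasure ρ] (k : Fin n),
      Measurable fun p : ℝ × (Fin (k : ℕ) → ℝ) => quantile (condDist ρ k k.2 p.2) p.1 := by
    intro ρ _ k
    have := ρ.isFiniteMeasure_map (splitMap k.1 k.2)
    exact measurable_quantile_kernel (ρ.map (splitMap k.1 k.2)).condKernel
  have hr : ∀ (ρ : Measure (Fin n → ℝ)) [IsProbabilityMeasure ρ] (u : Fin n → ℝ) (k : Fin n),
      krX ρ u k = quantile (condDist ρ k k.2 (histv k k.2.le (krX ρ u))) (u k) := by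
    intro ρ _ u k
    unfold krX
    rw [krVal]
    rfl
  have hlaw : ∀ (k : ℕ) (hk : k < n),
      ∀ᵐ z ∂(P.map (fun ω => (histv k hk.le (X ω), histv k hk.le (Y ω)))),
      lamU.map (fun u => (T ⟨k, hk⟩ u z.1, S ⟨k, hk⟩ u z.2)) =
      lamU.map (fun u => (quantile (condDist μ k hk z.1) u, quantile (condDist ν k hk z.2) u)) := by
    intro k hk
    have hXk : Measurable fun ω => histv k hk.le (X ω) := (measurable_histv k hk.le).comp hX
    have hYk : Measurable fun ω => histv k hk.le (Y ω) := (measurable_histv k hk.le).comp hY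
    have h1 := condDist_ae P U hUmeas hUindep hUl T hTmeas X hX hXrec μ hμ k hk
    have h2 := condDist_ae P U hUmeas hUindep hUl S hSmeas Y hY hYrec ν hν k hk
    have e1 : (P.map fun ω => histv k hk.le (X ω)) =
        (P.map (fun ω => (histv k hk.le (X ω), histv k hk.le (Y ω)))).map Prod.fst := by
      rw [Measure.map_map measurable_fst (hXk.prodMk hYk)]; rfl
    have e2 : (P.map fun ω => histv k hk.le (Y ω)) =
        (P.map (fun ω => (histv k hk.le (X ω), histv k hk.le (Y ω)))).map Prod.snd := by
      rw [Measure.map_map measurable_snd (hXk.prodMk hYk)]; rfl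
    rw [e1] at h1
    rw [e2] at h2
    filter_upwards [ae_of_ae_map measurable_fst.aemeasurable h1,
      ae_of_ae_map measurable_snd.aemeasurable h2] with z hz1 hz2
    rw [hz1, hz2]
    exact comonotone_law ((hTmeas ⟨k, hk⟩).comp measurable_prodMk_right)
      ((hSmeas ⟨k, hk⟩).comp measurable_prodMk_right) (hco ⟨k, hk⟩ z.1 z.2)
  exact coupling P U hUmeas hUindep hUl (uniformCube n) (fun k u => u k) hU' hind' hUl'
    T S (fun k u x => quantile (condDist μ k k.2 x) u) (fun k u x => quantile (condDist ν k k.2 x) u)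
    hTmeas hSmeas (hq μ) (hq ν) X Y (krX μ) (krX ν) hXrec hYrec (hr μ) (hr ν) hlaw n le_rfl


end
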